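/- Suppose g, h: ℝ^d → ℝ are continuous functions with zero means ⟨g⟩ = ⟨h⟩ = 0 along the probing signal Ω_t = (cos(2π(ω_1 t + φ_1)),…,cos(2π(ω_d t + φ_d))), whose frequencies satisfy the log-rational frequency condition. Suppose there exists a continuous function ĥ: ℂ^d → ℝ solving Poisson's equation ĥ(Φ_{t_0}) = ∫_{t_0}^{t_1}(h(Ω_t) − ⟨h⟩)dt + ĥ(Φ_{t_1}) for every initial phase, and every 0 ≤ t_0 ≤ t_1 < ∞. Then ⟨g(Ω)·ĥ(Φ)⟩ := lim_{T→∞}(1/T)∫_0^T g(Ω_t) ĥ(Φ_t) dt = 0. -/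

import Mathlib

open Filter MeasureTheory Topology Real

noncomputable section

/-- Probing signal with `V = I`: `Ω_t^i = cos(2π(ω_i t + φ_i))`. -/
def probe1 {d : ℕ} (ω φ : Fin d → ℝ) (t : ℝ) : Fin d → ℝ :=
  fun i => Real.cos (2 * π * (ω i * t + φ i))

/-- Complex exponential process `Φ_t^i = exp(2πj(ω_i t + φ_i))`. -/
def Phi {d : ℕ} (ω φ : Fin d → ℝ) (t : ℝ) : Fin d → ℂ :=
  fun i => Complex.exp (((2 * π * (ω i * t + φ i) : ℝ) : ℂ) * Complex.I)

/-- The log-rational frequency condition. -/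
def LogRatFreq {d : ℕ} (ω : Fin d → ℝ) : Prop :=
  (∀ i, 0 < ω i) ∧
  (∃ a b : Fin d → ℕ, (∀ i, 0 < a i) ∧ (∀ i, 0 < b i) ∧
      ∀ i, ω i = Real.log ((a i : ℝ) / (b i : ℝ))) ∧
  LinearIndependent ℚ ω

/-- The linear flow `t ↦ ω t + φ` on the torus. -/
def torusFlow {ι : Type*} (ω φ : ι → ℝ) (t : ℝ) : UnitAddTorus ι :=
  fun i => ((ω i * t + φ i : ℝ) : UnitAddCircle)

/-- The normalized Haar measure on the torus. -/
def torusHaar (ι : Type*) [Fintype ι] : Measure (UnitAddTorus ι) :=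
  Measure.pi fun _ => AddCircle.haarAddCircle

instance (ι : Type*) [Fintype ι] : IsProbabilityMeasure (torusHaar ι) := by
  unfold torusHaar; infer_instance

instance (ι : Type*) [Fintype ι] : (torusHaar ι).IsAddHaarMeasure := by
  unfold torusHaar; infer_instance

instance (ι : Type*) [Fintype ι] : (torusHaar ι).IsNegInvariant := by
  have : (AddCircle.haarAddCircle : Measure UnitAddCircle).IsNegInvariant := inferInstance
  unfold torusHaar; infer_instance

/-- The embedding of the torus into `ℂ^ι` as a product of unit circles. -/
def torusToComplex {ι : Type*} (x : UnitAddTorus ι) : ι → ℂ :=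
  fun i => (AddCircle.toCircle (x i) : ℂ)

section TorusFlow

variable {ι : Type*} (ω φ : ι → ℝ)

lemma continuous_torusFlow : Continuous (torusFlow ω φ) :=
  continuous_pi fun i => (AddCircle.continuous_mk' 1).comp (by fun_prop)

lemma torusFlow_zero : torusFlow ω φ 0 = fun i => (φ i : UnitAddCircle) := by
  funext i
  simp only [torusFlow, mul_zero, zero_add]

lemma neg_torusFlow (t : ℝ) : -torusFlow ω φ t = torusFlow ω (fun i => -(ω i * t + φ i)) 0 := by
  funext i
  change -((ω i * t + φ i : ℝ) : UnitAddCircle) = ((ω i * 0 + -(ω i * t + φ i) : ℝ) : UnitAddCircle)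
  rw [mul_zero, zero_add, AddCircle.coe_neg]

variable [Fintype ι] {ω}

lemma mFourier_torusFlow (n : ι → ℤ) (ω φ : ι → ℝ) (t : ℝ) :
    UnitAddTorus.mFourier n (torusFlow ω φ t) =
      Complex.exp ((2 * π * ∑ i, n i * ω i : ℝ) * Complex.I * t) *
        Complex.exp ((2 * π * ∑ i, n i * φ i : ℝ) * Complex.I) := by
  simp only [UnitAddTorus.mFourier, ContinuousMap.coe_mk, torusFlow, fourier_coe_apply]
  rw [← Complex.exp_sum, ← Complex.exp_add]
  congr 1
  push_cast
  simp only [Finset.mul_sum, Finset.sum_mul, ← Finset.sum_add_distrib]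
  exact Finset.sum_congr rfl fun i _ => by ring

lemma sum_intCast_mul_ne_zero (hω : LinearIndependent ℚ ω) {n : ι → ℤ} (hn : n ≠ 0) :
    ∑ i, (n i : ℝ) * ω i ≠ 0 := by
  intro h
  refine hn (funext fun i => ?_)
  have := Fintype.linearIndependent_iff.1 hω (fun i => (n i : ℚ))
    (by simpa [Rat.smul_def] using h) i
  exact_mod_cast this

lemma integral_mFourier_eq_zero (hω : LinearIndependent ℚ ω) {n : ι → ℤ} (hn : n ≠ 0) :
    ∫ x, UnitAddTorus.mFourier n x ∂torusHaar ι = 0 := by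
  have hs := sum_intCast_mul_ne_zero hω hn
  refine integral_eq_zero_of_add_right_eq_neg
    (g := torusFlow ω 0 (2 * ∑ i, (n i : ℝ) * ω i)⁻¹) fun x => ?_
  have hadd : ∀ x y, UnitAddTorus.mFourier n (x + y) =
      UnitAddTorus.mFourier n x * UnitAddTorus.mFourier n y := fun x y => by
    simp [UnitAddTorus.mFourier, fourier_apply, AddCircle.toCircle_add, Finset.prod_mul_distrib]
  rw [hadd, mFourier_torusFlow]
  have harg : ((2 * π * ∑ i, (n i : ℝ) * ω i : ℝ) : ℂ) * Complex.I *
      ((2 * ∑ i, (n i : ℝ) * ω i)⁻¹ : ℝ) = π * Complex.I := by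
    have hs' : ((∑ i, (n i : ℝ) * ω i : ℝ) : ℂ) ≠ 0 := by exact_mod_cast hs
    generalize (∑ i, (n i : ℝ) * ω i) = s at *
    push_cast
    field_simp
  rw [harg]
  simp [Complex.exp_pi_mul_I]

lemma tendsto_average_mFourier (hω : LinearIndependent ℚ ω) (φ : ι → ℝ) (n : ι → ℤ) :
    Tendsto (fun T : ℝ => T⁻¹ • ∫ t in (0 : ℝ)..T, UnitAddTorus.mFourier n (torusFlow ω φ t))
      atTop (𝓝 (∫ x, UnitAddTorus.mFourier n x ∂torusHaar ι)) := by
  rcases eq_or_ne n 0 with rfl | hn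
  · refine tendsto_const_nhds.congr' ?_
    filter_upwards [eventually_ne_atTop 0] with T hT
    simp [UnitAddTorus.mFourier_zero, hT]
  · rw [integral_mFourier_eq_zero hω hn]
    have hc : ((2 * π * ∑ i, (n i : ℝ) * ω i : ℝ) : ℂ) * Complex.I ≠ 0 := by
      have := sum_intCast_mul_ne_zero hω hn
      refine mul_ne_zero ?_ Complex.I_ne_zero
      exact_mod_cast mul_ne_zero (by positivity) this
    simp only [mFourier_torusFlow, intervalIntegral.integral_mul_const,
      integral_exp_mul_complex hc]
    refine NormedField.tendsto_zero_smul_of_tendsto_zero_of_bounded (𝕜 := ℝ)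
      tendsto_inv_atTop_zero ?_
    refine isBoundedUnder_of ⟨2 / ‖((2 * π * ∑ i, (n i : ℝ) * ω i : ℝ) : ℂ) * Complex.I‖,
      fun T => ?_⟩
    have h1 : ∀ s t : ℝ, ‖Complex.exp (s * Complex.I * t)‖ = 1 := fun s t => by
      rw [show (s : ℂ) * Complex.I * t = ((s * t : ℝ) : ℂ) * Complex.I by push_cast; ring]
      exact Complex.norm_exp_ofReal_mul_I _
    simp only [Function.comp_apply, norm_mul, norm_div, Complex.norm_exp_ofReal_mul_I, mul_one]
    rw [← norm_mul]
    gcongr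
    refine (norm_sub_le _ _).trans ?_
    rw [h1, h1]
    norm_num

/-- Weyl equidistribution: for rationally independent frequencies, time averages of continuous
functions along the linear flow converge to the space average. -/
theorem tendsto_average_torusFlow (hω : LinearIndependent ℚ ω) (φ : ι → ℝ)
    (F : C(UnitAddTorus ι, ℂ)) :
    Tendsto (fun T : ℝ => T⁻¹ • ∫ t in (0 : ℝ)..T, F (torusFlow ω φ t))
      atTop (𝓝 (∫ x, F x ∂torusHaar ι)) := by
  have hflow : ∀ (G : C(UnitAddTorus ι, ℂ)) (T : ℝ),
      IntervalIntegrable (fun t => G (torusFlow ω φ t)) volume 0 T := fun G T =>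
    (G.continuous.comp (continuous_torusFlow ω φ)).intervalIntegrable _ _
  have hintegral : ∀ G : C(UnitAddTorus ι, ℂ), Integrable (fun x => G x) (torusHaar ι) := fun G =>
    G.continuous.integrable_of_hasCompactSupport (HasCompactSupport.of_compactSpace _)
  have heq : Equicontinuous fun (T : ℝ) (G : C(UnitAddTorus ι, ℂ)) =>
      T⁻¹ • ∫ t in (0 : ℝ)..T, G (torusFlow ω φ t) := by
    refine (LipschitzWith.uniformEquicontinuous _ 1 fun T =>
      LipschitzWith.of_dist_le_mul fun G H => ?_).equicontinuous
    rw [dist_eq_norm, dist_eq_norm, ← smul_sub,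
      ← intervalIntegral.integral_sub (hflow G T) (hflow H T), norm_smul, NNReal.coe_one, one_mul]
    have := intervalIntegral.norm_integral_le_of_norm_le_const (a := 0) (b := T)
      (f := fun t => G (torusFlow ω φ t) - H (torusFlow ω φ t)) (C := ‖G - H‖)
      fun t _ => (G - H).norm_coe_le_norm _
    rcases eq_or_ne T 0 with rfl | hT
    · simp
    calc ‖T⁻¹‖ * _ ≤ ‖T⁻¹‖ * (‖G - H‖ * |T - 0|) := by gcongr
      _ = ‖G - H‖ := by
        rw [sub_zero, norm_inv, Real.norm_eq_abs]
        field_simp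
  have hcont : Continuous fun G : C(UnitAddTorus ι, ℂ) => ∫ x, G x ∂torusHaar ι := by
    refine (LipschitzWith.of_dist_le_mul (K := 1) fun G H => ?_).continuous
    rw [dist_eq_norm, dist_eq_norm, ← integral_sub (hintegral G) (hintegral H)]
    simpa using norm_integral_le_of_norm_le_const (μ := torusHaar ι)
      (f := fun x => G x - H x) (C := ‖G - H‖) (ae_of_all _ fun x => (G - H).norm_coe_le_norm x)
  have hspan : (Submodule.span ℂ (Set.range (UnitAddTorus.mFourier (d := ι))) :
      Set C(UnitAddTorus ι, ℂ)) ⊆ {G | Tendsto (fun T : ℝ => T⁻¹ • ∫ t in (0 : ℝ)..T,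
        G (torusFlow ω φ t)) atTop (𝓝 (∫ x, G x ∂torusHaar ι))} := by
    intro G hG
    induction hG using Submodule.span_induction with
    | mem G hG =>
      obtain ⟨n, rfl⟩ := hG
      exact tendsto_average_mFourier hω φ n
    | zero => simp
    | add G H _ _ hG hH =>
      simp only [Set.mem_ofPred_eq, ContinuousMap.add_apply] at hG hH ⊢
      rw [integral_add (hintegral G) (hintegral H)]
      refine (hG.add hH).congr fun T => ?_
      rw [intervalIntegral.integral_add (hflow G T) (hflow H T), smul_add]
    | smul c G _ hG =>
      simp only [Set.mem_ofPred_eq, ContinuousMap.smul_apply] at hG ⊢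
      rw [integral_smul]
      refine (hG.const_smul c).congr fun T => ?_
      rw [intervalIntegral.integral_smul, smul_comm]
  have htop : F ∈ (Submodule.span ℂ
      (Set.range (UnitAddTorus.mFourier (d := ι)))).topologicalClosure := by
    rw [UnitAddTorus.span_mFourier_closure_eq_top]
    trivial
  exact closure_minimal hspan (heq.isClosed_setOfPred_tendsto hcont) htop

theorem tendsto_average_torusFlow_real (hω : LinearIndependent ℚ ω) (φ : ι → ℝ)
    {f : UnitAddTorus ι → ℝ} (hf : Continuous f) :
    Tendsto (fun T : ℝ => T⁻¹ * ∫ t in (0 : ℝ)..T, f (torusFlow ω φ t))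
      atTop (𝓝 (∫ x, f x ∂torusHaar ι)) := by
  have h := tendsto_average_torusFlow hω φ ⟨fun x => (f x : ℂ), by fun_prop⟩
  simp only [ContinuousMap.coe_mk, intervalIntegral.integral_ofReal, integral_complex_ofReal,
    Complex.real_smul, ← Complex.ofReal_mul] at h
  simpa only [Function.comp_def, Complex.ofReal_re] using (Complex.continuous_re.tendsto _).comp h

/-- A continuous function on the torus that is constant along every forward orbit of a linear flow
with rationally independent frequencies is constant. -/
theorem eq_integral_of_torusFlow_invariant (hω : LinearIndependent ℚ ω)
    {f : UnitAddTorus ι → ℝ} (hf : Continuous f)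
    (hinv : ∀ φ t, 0 ≤ t → f (torusFlow ω φ t) = f (torusFlow ω φ 0)) (x : UnitAddTorus ι) :
    f x = ∫ y, f y ∂torusHaar ι := by
  choose φ hφ using fun i => QuotientAddGroup.mk_surjective (x i)
  have hx : torusFlow ω φ 0 = x := by
    rw [torusFlow_zero]
    exact funext hφ
  refine tendsto_nhds_unique (tendsto_const_nhds.congr' ?_)
    (tendsto_average_torusFlow_real hω φ hf)
  filter_upwards [eventually_gt_atTop 0] with T hT
  have : ∫ t in (0 : ℝ)..T, f (torusFlow ω φ t) = ∫ _ in (0 : ℝ)..T, f x :=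
    intervalIntegral.integral_congr fun t ht => by
      rw [Set.uIcc_of_le hT.le] at ht
      simp only [hinv φ t ht.1, hx]
  rw [this, intervalIntegral.integral_const, sub_zero, smul_eq_mul, inv_mul_cancel_left₀ hT.ne']

end TorusFlow

section Embedding

variable {ι : Type*}

lemma continuous_torusToComplex : Continuous (torusToComplex (ι := ι)) :=
  continuous_pi fun i =>
    continuous_subtype_val.comp (AddCircle.continuous_toCircle.comp (continuous_apply i))

lemma torusToComplex_neg_re (x : UnitAddTorus ι) (i : ι) :
    (torusToComplex (-x) i).re = (torusToComplex x i).re := by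
  simp [torusToComplex, AddCircle.toCircle_neg]

end Embedding

lemma torusToComplex_torusFlow {d : ℕ} (ω φ : Fin d → ℝ) (t : ℝ) :
    torusToComplex (torusFlow ω φ t) = Phi ω φ t := by
  ext i
  rw [torusToComplex, torusFlow, AddCircle.toCircle_apply_mk, Circle.coe_exp, div_one, Phi]

lemma re_torusToComplex_torusFlow {d : ℕ} (ω φ : Fin d → ℝ) (t : ℝ) :
    (fun i => (torusToComplex (torusFlow ω φ t) i).re) = probe1 ω φ t := by
  ext i
  rw [torusToComplex_torusFlow, Phi, Complex.exp_ofReal_mul_I_re, probe1]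

/-- If `hhat` solves Poisson's equation, then `hhat(Φ) + hhat(conj Φ)` is constant along orbits. -/
lemma poisson_add_neg_invariant {d : ℕ} {ω : Fin d → ℝ} {h : (Fin d → ℝ) → ℝ}
    {hhat : (Fin d → ℂ) → ℝ}
    (hPoisson : ∀ φ : Fin d → ℝ, ∀ t0 t1 : ℝ, 0 ≤ t0 → t0 ≤ t1 →
      hhat (Phi ω φ t0) = (∫ t in t0..t1, h (probe1 ω φ t)) + hhat (Phi ω φ t1))
    (φ : Fin d → ℝ) (t : ℝ) (ht : 0 ≤ t) :
    hhat (torusToComplex (torusFlow ω φ t)) + hhat (torusToComplex (-torusFlow ω φ t)) =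
      hhat (torusToComplex (torusFlow ω φ 0)) + hhat (torusToComplex (-torusFlow ω φ 0)) := by
  set ψ : Fin d → ℝ := fun i => -(ω i * t + φ i) with hψ
  have hend : -torusFlow ω φ 0 = torusFlow ω ψ t := by
    rw [neg_torusFlow]
    ext i
    simp [torusFlow, hψ]
  have hrev : ∀ s, probe1 ω ψ s = probe1 ω φ (t - s) := fun s => by
    ext i
    rw [probe1, probe1, ← Real.cos_neg]
    congr 1
    simp only [hψ]
    ring
  have hintegral : ∫ s in (0 : ℝ)..t, h (probe1 ω ψ s) = ∫ s in (0 : ℝ)..t, h (probe1 ω φ s) := by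
    simp only [hrev]
    simpa using intervalIntegral.integral_comp_sub_left (a := 0) (b := t)
      (fun s => h (probe1 ω φ s)) t
  rw [hend, neg_torusFlow, ← hψ]
  simp only [torusToComplex_torusFlow]
  rw [hPoisson φ 0 t le_rfl ht, hPoisson ψ 0 t le_rfl ht, hintegral]
  ring

/-- for continuous zero-mean `g, h` and a continuous solution `ĥ` of
Poisson's equation valid for every initial phase, the steady-state correlation
`⟨g(Ω)·ĥ(Φ)⟩` vanishes. -/
theorem continuous_orthogonality {d : ℕ} (ω : Fin d → ℝ) (hω : LogRatFreq ω)
    (g h : (Fin d → ℝ) → ℝ) (hgc : Continuous g) (hhc : Continuous h)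
    (hhat : (Fin d → ℂ) → ℝ) (hhatc : Continuous hhat)
    (hgmean : ∀ φ : Fin d → ℝ,
      Tendsto (fun T : ℝ => T⁻¹ * ∫ t in (0:ℝ)..T, g (probe1 ω φ t)) atTop (𝓝 0))
    (hhmean : ∀ φ : Fin d → ℝ,
      Tendsto (fun T : ℝ => T⁻¹ * ∫ t in (0:ℝ)..T, h (probe1 ω φ t)) atTop (𝓝 0))
    (hPoisson : ∀ φ : Fin d → ℝ, ∀ t0 t1 : ℝ, 0 ≤ t0 → t0 ≤ t1 →
      hhat (Phi ω φ t0)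
        = (∫ t in t0..t1, h (probe1 ω φ t)) + hhat (Phi ω φ t1)) :
    ∀ φ : Fin d → ℝ,
      Tendsto (fun T : ℝ => T⁻¹ * ∫ t in (0:ℝ)..T, g (probe1 ω φ t) * hhat (Phi ω φ t))
        atTop (𝓝 0) := by
  have hind := hω.2.2
  intro φ
  set G : UnitAddTorus (Fin d) → ℝ := fun x => g fun i => (torusToComplex x i).re with hG
  set H : UnitAddTorus (Fin d) → ℝ := fun x => hhat (torusToComplex x) with hH
  have hGc : Continuous G := hgc.comp <| continuous_pi fun i =>
    Complex.continuous_re.comp ((continuous_apply i).comp continuous_torusToComplex)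
  have hHc : Continuous H := hhatc.comp continuous_torusToComplex
  have hGflow : ∀ t, G (torusFlow ω φ t) = g (probe1 ω φ t) := fun t => by
    simp only [hG, re_torusToComplex_torusFlow]
  have hHflow : ∀ t, H (torusFlow ω φ t) = hhat (Phi ω φ t) := fun t => by
    simp only [hH, torusToComplex_torusFlow]
  have hGneg : ∀ x, G (-x) = G x := fun x => by simp only [hG, torusToComplex_neg_re]
  have hGint : ∫ x, G x ∂torusHaar (Fin d) = 0 := by
    refine tendsto_nhds_unique (tendsto_average_torusFlow_real hind φ hGc) ?_
    simpa only [hGflow] using hgmean φ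
  have hsum := eq_integral_of_torusFlow_invariant hind (f := fun x => H x + H (-x))
    (hHc.add (hHc.comp continuous_neg)) (poisson_add_neg_invariant hPoisson)
  set c := ∫ y, (H y + H (-y)) ∂torusHaar (Fin d)
  have hintegral : ∀ {f : UnitAddTorus (Fin d) → ℝ}, Continuous f →
      Integrable f (torusHaar (Fin d)) := fun hf =>
    hf.integrable_of_hasCompactSupport (HasCompactSupport.of_compactSpace _)
  have hzero : ∫ x, G x * H x ∂torusHaar (Fin d) = 0 := by
    have hneg : ∫ x, G x * H (-x) ∂torusHaar (Fin d) = ∫ x, G x * H x ∂torusHaar (Fin d) := by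
      simpa only [hGneg] using integral_neg_eq_self (fun x => G x * H x) (torusHaar (Fin d))
    have hadd : ∫ x, G x * H x ∂torusHaar (Fin d) + ∫ x, G x * H (-x) ∂torusHaar (Fin d) = 0 := by
      rw [← integral_add (hintegral (f := fun x => G x * H x) (by fun_prop))
        (hintegral (f := fun x => G x * H (-x)) (by fun_prop))]
      simp only [← mul_add, hsum, integral_mul_const, hGint, zero_mul]
    linarith
  have havg := tendsto_average_torusFlow_real hind φ (f := fun x => G x * H x) (by fun_prop)
  simpa only [hGflow, hHflow, hzero] using havg
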